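/- Let ν be a dissipative shift-invariant tail measure with index α > 0, with moving shift representation given by Z̃ and spectral tail process Θ, and let τ : E^ℤ → [0,∞] be measurable, 1-homogeneous with ν({x : τ(x) > 1}) = 1. Then the maximal index satisfies θ_τ > 0 and θ_τ = E[sup_{h∈ℤ} τ^α(B^h Z̃)] = E[ (sup_{h∈ℤ} τ^α(B^h Θ)) / (Σ_{h∈ℤ} ‖Θ_h‖^α) ]. Moreover, if P(I(Θ) = 0) > 0 and Q is a process with the conditional law of Θ given I(Θ) = 0, then θ_τ = P(I(Θ)=0) · E[sup_{h∈ℤ} τ^α(B^h Q)]. -/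

import Mathlib

open MeasureTheory
open scoped ENNReal

/-- A measurable cone: a measurable space `E` with a measurable multiplication by positive
scalars, a zero element and a measurable `1`-homogeneous pseudonorm. -/
structure MeasCone (E : Type*) [MeasurableSpace E] where
  smul : ℝ → E → E
  zero : E
  nrm : E → ℝ
  measurable_smul : Measurable fun p : ℝ × E => smul p.1 p.2
  measurable_nrm : Measurable nrm
  one_smul : ∀ x, smul 1 x = x
  smul_smul : ∀ (u v : ℝ), 0 < u → 0 < v → ∀ x, smul u (smul v x) = smul (u * v) x
  smul_zero' : ∀ (u : ℝ), 0 < u → smul u zero = zero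
  nrm_nonneg : ∀ x, 0 ≤ nrm x
  nrm_smul : ∀ (u : ℝ), 0 < u → ∀ x, nrm (smul u x) = u * nrm x
  eq_zero_of_nrm : ∀ x, nrm x = 0 → x = zero

/-- The `k`-th iterate of the backshift operator: `(B^k x)_h = x_{h-k}`. -/
def seqShift {E : Type*} (k : ℤ) (x : ℤ → E) : ℤ → E := fun h => x (h - k)

/-- Shift invariance of a measure on `E^ℤ`: `ν(BA) = ν(A)` for all measurable `A`. -/
def ShiftInvariant {E : Type*} [MeasurableSpace E] (ν : MeasureTheory.Measure (ℤ → E)) : Prop :=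
  ∀ A : Set (ℤ → E), MeasurableSet A → ν (seqShift 1 '' A) = ν A

namespace MeasCone

variable {E : Type*} [MeasurableSpace E] (K : MeasCone E)

/-- The sequence identically equal to the zero element. -/
def zeroSeq : ℤ → E := fun _ => K.zero

/-- Componentwise scalar multiplication on the sequence space `E^ℤ`. -/
def sSmul (u : ℝ) (x : ℤ → E) : ℤ → E := fun h => K.smul u (x h)


/-- A tail measure with index `α > 0` on `E^ℤ`. -/
def IsTailMeasure (α : ℝ) (ν : Measure (ℤ → E)) : Prop :=
  ν {K.zeroSeq} = 0 ∧
  ν {x | 1 < K.nrm (x 0)} = 1 ∧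
  (∀ h : ℤ, ν {x | 1 < K.nrm (x h)} < ⊤) ∧
  ∀ (u : ℝ), 0 < u → ∀ A : Set (ℤ → E), MeasurableSet A →
    ν (K.sSmul u '' A) = ENNReal.ofReal (u ^ (-α)) * ν A

/-- The spectral map at lag `h`: `x ↦ x / ‖x_h‖`. -/
noncomputable def spectralMap (h : ℤ) (x : ℤ → E) : ℤ → E :=
  fun j => K.smul (K.nrm (x h))⁻¹ (x j)

/-- The law of the local spectral tail process of `ν` at lag `h`:
the pushforward under the spectral map of (the normalization of) the restriction of `ν`
to `{x : ‖x_h‖ > 1}`. -/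
noncomputable def spectralLaw (ν : Measure (ℤ → E)) (h : ℤ) : Measure (ℤ → E) :=
  Measure.map (K.spectralMap h)
    ((ν {x | 1 < K.nrm (x h)})⁻¹ • ν.restrict {x | 1 < K.nrm (x h)})

/-- The time change formula for (the law of) a process `Θ`:
`E[H₀(B^h Θ)] = E[‖Θ_h‖^α H₀(Θ)]` for every measurable `0`-homogeneous
`H₀ : E^ℤ → [0,∞)` vanishing on `{x : ‖x_0‖ = 0}`. -/
def SatisfiesTCF (α : ℝ) (μ : Measure (ℤ → E)) : Prop :=
  ∀ (h : ℤ) (H : (ℤ → E) → ℝ), Measurable H → (∀ x, 0 ≤ H x) →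
    (∀ (u : ℝ), 0 < u → ∀ x, H (K.sSmul u x) = H x) →
    (∀ x, K.nrm (x 0) = 0 → H x = 0) →
    ∫⁻ x, ENNReal.ofReal (H (seqShift h x)) ∂μ
      = ∫⁻ x, ENNReal.ofReal (K.nrm (x h) ^ α) * ENNReal.ofReal (H x) ∂μ

/-- `I(x) = j ∈ ℤ` for the infargmax functional:
`sup_{k ≤ j-1} ‖x_k‖ < ‖x_j‖ = sup_{k ∈ ℤ} ‖x_k‖`. -/
def IsInfArgmax (x : ℤ → E) (j : ℤ) : Prop :=
  (⨆ k : ℤ, ⨆ _ : k < j, ENNReal.ofReal (K.nrm (x k))) < ENNReal.ofReal (K.nrm (x j)) ∧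
  ENNReal.ofReal (K.nrm (x j)) = ⨆ k : ℤ, ENNReal.ofReal (K.nrm (x k))

end MeasCone

theorem measurable_seqShift {E : Type*} [MeasurableSpace E] (k : ℤ) :
    Measurable (seqShift k : (ℤ → E) → ℤ → E) :=
  measurable_pi_lambda _ fun h => measurable_pi_apply (h - k)

theorem seqShift_seqShift {E : Type*} (j k : ℤ) (x : ℤ → E) :
    seqShift j (seqShift k x) = seqShift (k + j) x := by
  funext h
  simp only [seqShift]
  congr 1
  ring

/-- The `α`-power measure `α r^{-α-1} dr` on the positive half-line. -/
noncomputable def powerMeasure (α : ℝ) : Measure ℝ :=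
  (volume.restrict (Set.Ioi (0 : ℝ))).withDensity fun r => ENNReal.ofReal (α * r ^ (-α - 1))

instance (α : ℝ) : SFinite (powerMeasure α) := by
  unfold powerMeasure
  infer_instance

theorem measurable_powerDensity (α : ℝ) :
    Measurable fun r : ℝ => ENNReal.ofReal (α * r ^ (-α - 1)) := by
  fun_prop

theorem powerMeasure_ae_pos (α : ℝ) : ∀ᵐ r ∂powerMeasure α, 0 < r :=
  (withDensity_absolutelyContinuous _ _).ae_le (ae_restrict_mem measurableSet_Ioi)

theorem powerMeasure_Ioi {α : ℝ} (hα : 0 < α) {c : ℝ} (hc : 0 < c) :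
    powerMeasure α (Set.Ioi c) = ENNReal.ofReal (c ^ (-α)) := by
  rw [powerMeasure, withDensity_apply _ measurableSet_Ioi,
    Measure.restrict_restrict measurableSet_Ioi,
    Set.inter_eq_left.2 (Set.Ioi_subset_Ioi hc.le),
    ← ofReal_integral_eq_lintegral_ofReal]
  · rw [integral_const_mul, integral_Ioi_rpow_of_lt (by linarith) hc]
    congr 1
    have : -α - 1 + 1 = -α := by ring
    rw [this]
    field_simp
  · exact (integrableOn_Ioi_rpow_of_lt (by linarith) hc).const_mul α
  · filter_upwards [ae_restrict_mem measurableSet_Ioi] with r hr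
    have : 0 < r := hc.trans hr
    positivity

theorem powerMeasure_scaled_gt {α : ℝ} (hα : 0 < α) (t : ℝ≥0∞) :
    powerMeasure α {r | 1 < ENNReal.ofReal r * t} = t ^ α := by
  have finite_case : ∀ s : ℝ, 0 < s →
      powerMeasure α {r | 1 < ENNReal.ofReal r * ENNReal.ofReal s} = ENNReal.ofReal s ^ α := by
    intro s hs
    have hset : {r : ℝ | 1 < ENNReal.ofReal r * ENNReal.ofReal s} = Set.Ioi s⁻¹ := by
      ext r
      simp only [Set.mem_ofPred_eq, Set.mem_Ioi]
      rw [← ENNReal.ofReal_mul' hs.le, ENNReal.one_lt_ofReal, inv_lt_iff_one_lt_mul₀ hs, mul_comm]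
    rw [hset, powerMeasure_Ioi hα (inv_pos.2 hs), ENNReal.ofReal_rpow_of_pos hs,
      Real.inv_rpow hs.le, Real.rpow_neg hs.le, inv_inv]
  rcases eq_or_ne t 0 with rfl | h0
  · simp [ENNReal.zero_rpow_of_pos hα]
  rcases eq_or_ne t ⊤ with rfl | hT
  · rw [ENNReal.top_rpow_of_pos hα]
    refine ENNReal.eq_top_of_forall_nnreal_le fun q => ?_
    have hs : 0 < ((q : ℝ) + 1) ^ α⁻¹ := by positivity
    have h1 : powerMeasure α {r | 1 < ENNReal.ofReal r * ENNReal.ofReal (((q : ℝ) + 1) ^ α⁻¹)}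
        ≤ powerMeasure α {r | 1 < ENNReal.ofReal r * ⊤} := by
      refine measure_mono fun r hr => ?_
      rw [Set.mem_ofPred_eq] at hr ⊢
      exact hr.trans_le (mul_le_mul_right le_top _)
    refine le_trans ?_ h1
    rw [finite_case _ hs, ENNReal.ofReal_rpow_of_pos hs, ← Real.rpow_mul (by positivity),
      inv_mul_cancel₀ hα.ne', Real.rpow_one, ← ENNReal.ofReal_coe_nnreal]
    exact ENNReal.ofReal_le_ofReal (by linarith)
  · have := finite_case t.toReal (ENNReal.toReal_pos h0 hT)
    rwa [ENNReal.ofReal_toReal hT] at this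

theorem iSup_window_le (a : ℤ → ℝ≥0∞) (n m : ℕ) (h : ℤ) :
    ⨆ k : ℕ, ⨆ _ : k < n, a (h + k) ≤
      (if h ∈ Finset.Ioc (-(m : ℤ) - n) m then ⨆ j, a j else 0) +
        ∑ k ∈ Finset.range n, if h + k ∈ Finset.Icc (-(m : ℤ)) m then 0 else a (h + k) := by
  refine iSup₂_le fun k hk => ?_
  by_cases hm : h + k ∈ Finset.Icc (-(m : ℤ)) m
  · have hh : h ∈ Finset.Ioc (-(m : ℤ) - n) m := by
      simp only [Finset.mem_Icc, Finset.mem_Ioc] at hm ⊢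
      omega
    rw [if_pos hh]
    exact (le_iSup a (h + k)).trans le_self_add
  · refine le_trans ?_ le_add_self
    have := Finset.single_le_sum
      (f := fun k : ℕ => if h + k ∈ Finset.Icc (-(m : ℤ)) m then 0 else a (h + k))
      (fun _ _ => zero_le) (Finset.mem_range.2 hk)
    simpa only [if_neg hm] using this

theorem tsum_window_le (a : ℤ → ℝ≥0∞) (n m : ℕ) :
    ∑' h : ℤ, ⨆ k : ℕ, ⨆ _ : k < n, a (h + k) ≤
      ((2 * m + n : ℕ) : ℝ≥0∞) * (⨆ j, a j) +
        n * ∑' j : ℤ, if j ∈ Finset.Icc (-(m : ℤ)) m then 0 else a j := by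
  refine (ENNReal.tsum_le_tsum fun h => iSup_window_le a n m h).trans ?_
  rw [ENNReal.tsum_add]
  refine add_le_add (le_of_eq ?_) (le_of_eq ?_)
  · rw [tsum_eq_sum (s := Finset.Ioc (-(m : ℤ) - n) m) (fun h hh => if_neg hh),
      Finset.sum_ite_mem, Finset.inter_self, Finset.sum_const, nsmul_eq_mul, Int.card_Ioc]
    congr 2
    omega
  · rw [Summable.tsum_finsetSum fun _ _ => ENNReal.summable]
    have : ∀ k : ℕ, (∑' h : ℤ, if h + k ∈ Finset.Icc (-(m : ℤ)) m then 0 else a (h + k)) =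
        ∑' j : ℤ, if j ∈ Finset.Icc (-(m : ℤ)) m then 0 else a j := fun k =>
      (Equiv.addRight (k : ℤ)).tsum_eq
        (fun j : ℤ => if j ∈ Finset.Icc (-(m : ℤ)) m then 0 else a j)
    rw [Finset.sum_congr rfl fun k _ => this k, Finset.sum_const, nsmul_eq_mul, Finset.card_range]

theorem le_tsum_window (a : ℤ → ℝ≥0∞) (n m : ℕ) :
    (n : ℝ≥0∞) * (⨆ j ∈ Finset.Icc (-(m : ℤ)) m, a j) ≤
      (∑' h : ℤ, ⨆ k : ℕ, ⨆ _ : k < n, a (h + k)) +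
        ((2 * m : ℕ) : ℝ≥0∞) * (⨆ j ∈ Finset.Icc (-(m : ℤ)) m, a j) := by
  have hsum : ((n - 2 * m : ℕ) : ℝ≥0∞) * (⨆ j ∈ Finset.Icc (-(m : ℤ)) m, a j) ≤
      ∑' h : ℤ, ⨆ k : ℕ, ⨆ _ : k < n, a (h + k) := by
    refine le_trans ?_ (ENNReal.sum_le_tsum (Finset.Ioc ((m : ℤ) - n) (-m)))
    have hcard : (Finset.Ioc ((m : ℤ) - n) (-m)).card = n - 2 * m := by
      rw [Int.card_Ioc]
      omega
    rw [← hcard, ← nsmul_eq_mul]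
    refine Finset.card_nsmul_le_sum _ _ _ fun h hh => iSup₂_le fun j hj => ?_
    simp only [Finset.mem_Icc, Finset.mem_Ioc] at hh hj
    refine le_iSup₂_of_le (j - h).toNat (by omega) (le_of_eq ?_)
    congr 1
    omega
  refine le_trans ?_ (add_le_add_left hsum _)
  rw [← add_mul]
  gcongr
  rw [← Nat.cast_add]
  exact_mod_cast (by omega : n ≤ n - 2 * m + 2 * m)

theorem tendsto_const_mul_inv_natCast {c : ℝ≥0∞} (hc : c ≠ ⊤) :
    Filter.Tendsto (fun n : ℕ => c * (n : ℝ≥0∞)⁻¹) Filter.atTop (nhds 0) := by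
  simpa using ENNReal.Tendsto.const_mul ENNReal.tendsto_inv_nat_nhds_zero (Or.inr hc)

/-- Averages of sliding window maxima of a random summable sequence converge to the mean of the
overall supremum. -/
theorem limit_window_eq {Ω : Type*} [MeasurableSpace Ω] (P : Measure Ω)
    (a : ℤ → Ω → ℝ≥0∞) (ha : ∀ j, Measurable (a j)) (hfin : ∑' j, ∫⁻ ω, a j ω ∂P ≠ ⊤)
    (u : ℕ → ℝ≥0∞)
    (hu : ∀ n : ℕ, u n = ∫⁻ ω, ∑' h : ℤ, ⨆ k : ℕ, ⨆ _ : k < n, a (h + k) ω ∂P)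
    (θ : ℝ≥0∞)
    (hθ : Filter.Tendsto (fun n : ℕ => u n / (n : ℝ≥0∞)) Filter.atTop (nhds θ)) :
    θ = ∫⁻ ω, ⨆ j, a j ω ∂P := by
  have hM : ∫⁻ ω, ⨆ j, a j ω ∂P ≠ ⊤ := by
    refine ne_top_of_le_ne_top hfin ?_
    rw [← lintegral_tsum fun j => (ha j).aemeasurable]
    exact lintegral_mono fun ω => iSup_le fun j => ENNReal.le_tsum j
  have hsupm : Measurable fun ω => ⨆ j, a j ω := Measurable.iSup ha
  have cancel : ∀ n : ℕ, 0 < n → ∀ x : ℝ≥0∞, (n : ℝ≥0∞) * x * (n : ℝ≥0∞)⁻¹ = x := by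
    intro n hn x
    rw [mul_comm (n : ℝ≥0∞) x, mul_assoc, ENNReal.mul_inv_cancel (by exact_mod_cast hn.ne')
      (ENNReal.natCast_ne_top n), mul_one]
  apply le_antisymm
  · have upper : ∀ m : ℕ, θ ≤ (∫⁻ ω, ⨆ j, a j ω ∂P) +
        ∑' j : ℤ, if j ∈ Finset.Icc (-(m : ℤ)) m then 0 else ∫⁻ ω, a j ω ∂P := by
      intro m
      set T := ∑' j : ℤ, if j ∈ Finset.Icc (-(m : ℤ)) m then 0 else ∫⁻ ω, a j ω ∂P with hT
      set M := ∫⁻ ω, ⨆ j, a j ω ∂P with hMdef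
      have hbound : ∀ n : ℕ, u n ≤ ((2 * m + n : ℕ) : ℝ≥0∞) * M + n * T := by
        intro n
        have hmeas : ∀ j : ℤ, Measurable fun ω =>
            if j ∈ Finset.Icc (-(m : ℤ)) m then 0 else a j ω := by
          intro j
          split_ifs
          · exact measurable_const
          · exact ha j
        rw [hu n]
        refine (lintegral_mono fun ω => tsum_window_le (fun j => a j ω) n m).trans (le_of_eq ?_)
        rw [lintegral_add_left (hsupm.const_mul _), lintegral_const_mul _ hsupm,
          lintegral_const_mul _ (Measurable.tsum hmeas),
          lintegral_tsum fun j => (hmeas j).aemeasurable]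
        congr 3
        funext j
        split_ifs <;> simp
      have hlim : Filter.Tendsto
          (fun n : ℕ => M + T + (((2 * m : ℕ) : ℝ≥0∞) * M) * (n : ℝ≥0∞)⁻¹) Filter.atTop
          (nhds (M + T + 0)) :=
        tendsto_const_nhds.add (tendsto_const_mul_inv_natCast
          (ENNReal.mul_ne_top (ENNReal.natCast_ne_top _) hM))
      rw [add_zero] at hlim
      refine le_of_tendsto_of_tendsto hθ hlim ?_
      filter_upwards [Filter.eventually_gt_atTop 0] with n hn
      rw [div_eq_mul_inv]
      refine (mul_le_mul_left (hbound n) _).trans (le_of_eq ?_)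
      rw [Nat.cast_add, add_mul, add_mul, add_mul, cancel n hn, cancel n hn]
      ring
    have htail : Filter.Tendsto (fun m : ℕ =>
        ∑' j : ℤ, if j ∈ Finset.Icc (-(m : ℤ)) m then 0 else ∫⁻ ω, a j ω ∂P)
        Filter.atTop (nhds 0) := by
      have hIcc : Filter.Tendsto (fun m : ℕ => Finset.Icc (-(m : ℤ)) m)
          Filter.atTop Filter.atTop := by
        refine Filter.tendsto_atTop_finset_of_monotone (fun i j hij => ?_) fun x =>
          ⟨x.natAbs, Finset.mem_Icc.2 (by omega)⟩
        exact Finset.Icc_subset_Icc (by omega) (by omega)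
      refine ((ENNReal.tendsto_tsum_compl_atTop_zero hfin).comp hIcc).congr fun m => ?_
      simp only [Function.comp]
      refine (tsum_subtype {j : ℤ | j ∉ Finset.Icc (-(m : ℤ)) m}
        fun j => ∫⁻ ω, a j ω ∂P).trans ?_
      refine tsum_congr fun j => ?_
      by_cases hj : j ∈ Finset.Icc (-(m : ℤ)) m
      · rw [if_pos hj, Set.indicator_of_notMem
          (fun hn : j ∉ Finset.Icc (-(m : ℤ)) m => hn hj)]
      · rw [if_neg hj, Set.indicator_of_mem
          (show j ∈ {j : ℤ | j ∉ Finset.Icc (-(m : ℤ)) m} from hj)]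
    simpa using ge_of_tendsto' (tendsto_const_nhds.add htail) upper
  · have hmeas : ∀ m : ℕ, Measurable fun ω => ⨆ j ∈ Finset.Icc (-(m : ℤ)) m, a j ω := fun m =>
      Measurable.iSup fun j => Measurable.iSup fun _ => ha j
    have lower : ∀ m : ℕ, ∫⁻ ω, ⨆ j ∈ Finset.Icc (-(m : ℤ)) m, a j ω ∂P ≤ θ := by
      intro m
      set M := ∫⁻ ω, ⨆ j ∈ Finset.Icc (-(m : ℤ)) m, a j ω ∂P with hMdef
      have hMfin : M ≠ ⊤ := ne_top_of_le_ne_top hM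
        (lintegral_mono fun ω => iSup₂_le fun j _ => le_iSup (fun j => a j ω) j)
      have hbound : ∀ n : ℕ, (n : ℝ≥0∞) * M ≤ u n + ((2 * m : ℕ) : ℝ≥0∞) * M := by
        intro n
        rw [hu n, hMdef, ← lintegral_const_mul _ (hmeas m), ← lintegral_const_mul _ (hmeas m),
          ← lintegral_add_right _ ((hmeas m).const_mul _)]
        exact lintegral_mono fun ω => le_tsum_window (fun j => a j ω) n m
      have hlim := hθ.add (tendsto_const_mul_inv_natCast
        (ENNReal.mul_ne_top (ENNReal.natCast_ne_top (2 * m)) hMfin))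
      rw [add_zero] at hlim
      refine ge_of_tendsto hlim ?_
      filter_upwards [Filter.eventually_gt_atTop 0] with n hn
      rw [div_eq_mul_inv, ← add_mul]
      calc M = (n : ℝ≥0∞) * M * (n : ℝ≥0∞)⁻¹ := (cancel n hn M).symm
        _ ≤ _ := mul_le_mul_left (hbound n) _
    have hsup : ∀ ω, ⨆ j, a j ω = ⨆ m : ℕ, ⨆ j ∈ Finset.Icc (-(m : ℤ)) m, a j ω := by
      intro ω
      refine le_antisymm (iSup_le fun j => ?_) (iSup_le fun m => iSup₂_le fun j _ =>
        le_iSup (fun j => a j ω) j)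
      exact le_iSup_of_le j.natAbs
        (le_iSup₂_of_le j (Finset.mem_Icc.2 (by omega)) le_rfl)
    simp_rw [hsup]
    rw [lintegral_iSup hmeas]
    · exact iSup_le lower
    · intro i j hij ω
      exact biSup_mono fun k hk => Finset.Icc_subset_Icc (by omega) (by omega) hk

namespace MeasCone

section

variable {E : Type*} [MeasurableSpace E] (K : MeasCone E)

theorem measurable_sSmul : Measurable fun p : ℝ × (ℤ → E) => K.sSmul p.1 p.2 :=
  measurable_pi_lambda _ fun h => K.measurable_smul.comp
    (measurable_fst.prodMk ((measurable_pi_apply h).comp measurable_snd))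

theorem measurable_nrm_apply (k : ℤ) : Measurable fun x : ℤ → E => K.nrm (x k) :=
  K.measurable_nrm.comp (measurable_pi_apply k)

theorem measurable_spectralMap : Measurable (K.spectralMap 0) :=
  K.measurable_sSmul.comp ((K.measurable_nrm_apply 0).inv.prodMk measurable_id)

theorem seqShift_sSmul (k : ℤ) (r : ℝ) (x : ℤ → E) :
    seqShift k (K.sSmul r x) = K.sSmul r (seqShift k x) := rfl

theorem ofReal_nrm_sSmul {r : ℝ} (hr : 0 < r) (x : ℤ → E) (k : ℤ) :
    ENNReal.ofReal (K.nrm (K.sSmul r x k)) = ENNReal.ofReal r * ENNReal.ofReal (K.nrm (x k)) := by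
  rw [sSmul, K.nrm_smul r hr, ENNReal.ofReal_mul hr.le]

/-- A moving shift representation of `ν` integrates a `0`-homogeneous function `G` over the
exceedance set of a `1`-homogeneous function `φ`. -/
theorem setLIntegral_of_movingShift {α : ℝ} (hα : 0 < α) (ν : Measure (ℤ → E))
    {Ω : Type*} [MeasurableSpace Ω] (P : Measure Ω) [IsProbabilityMeasure P]
    (Zt : Ω → ℤ → E) (hZmeas : Measurable Zt)
    (hrep : ∀ A : Set (ℤ → E), MeasurableSet A →
      ν A = ∑' h : ℤ, ∫⁻ r in Set.Ioi (0 : ℝ),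
        P {ω | K.sSmul r (seqShift h (Zt ω)) ∈ A}
          * ENNReal.ofReal (α * r ^ (-α - 1)) ∂volume)
    (φ : (ℤ → E) → ℝ≥0∞) (hφ : Measurable φ)
    (hφhom : ∀ (u : ℝ), 0 < u → ∀ x, φ (K.sSmul u x) = ENNReal.ofReal u * φ x)
    (G : (ℤ → E) → ℝ≥0∞) (hG : Measurable G)
    (hGhom : ∀ (u : ℝ), 0 < u → ∀ x, G (K.sSmul u x) = G x) :
    ∫⁻ x in {x | 1 < φ x}, G x ∂ν =
      ∫⁻ ω, ∑' h : ℤ, φ (seqShift h (Zt ω)) ^ α * G (seqShift h (Zt ω)) ∂P := by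
  have hshift : ∀ h : ℤ, Measurable fun ω => seqShift h (Zt ω) := fun h =>
    (measurable_seqShift h).comp hZmeas
  have hmap : ∀ h : ℤ, Measurable fun p : ℝ × Ω => K.sSmul p.1 (seqShift h (Zt p.2)) := fun h =>
    K.measurable_sSmul.comp (measurable_fst.prodMk ((hshift h).comp measurable_snd))
  have hsum : ν = Measure.sum fun h : ℤ =>
      Measure.map (fun p : ℝ × Ω => K.sSmul p.1 (seqShift h (Zt p.2)))
        ((powerMeasure α).prod P) := by
    refine Measure.ext fun A hA => ?_
    rw [hrep A hA, Measure.sum_apply _ hA]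
    refine tsum_congr fun h => ?_
    rw [Measure.map_apply (hmap h) hA, Measure.prod_apply (hmap h hA), powerMeasure,
      lintegral_withDensity_eq_lintegral_mul _ (measurable_powerDensity α)
        (measurable_measure_prodMk_left (hmap h hA))]
    refine lintegral_congr fun r => ?_
    rw [Pi.mul_apply, mul_comm]
    rfl
  have hset : MeasurableSet {x | 1 < φ x} := measurableSet_lt measurable_const hφ
  have hind : Measurable ({x | 1 < φ x}.indicator G) := hG.indicator hset
  rw [← lintegral_indicator hset, hsum, lintegral_sum_measure, lintegral_tsum]
  · refine tsum_congr fun h => ?_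
    rw [lintegral_map hind (hmap h)]
    refine (lintegral_prod_symm _ (hind.comp (hmap h)).aemeasurable).trans ?_
    refine lintegral_congr fun ω => ?_
    rw [← powerMeasure_scaled_gt hα (φ (seqShift h (Zt ω))), mul_comm,
      ← lintegral_indicator_const (measurableSet_lt measurable_const
        (ENNReal.measurable_ofReal.mul_const _))]
    refine lintegral_congr_ae ?_
    filter_upwards [powerMeasure_ae_pos α] with r hr
    simp only [Function.comp, Set.indicator, Set.mem_ofPred_eq, hφhom r hr, hGhom r hr]
  · exact fun h => (((hφ.comp (hshift h)).pow_const α).mul (hG.comp (hshift h))).aemeasurable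

/-- Integrals against the spectral law in terms of a moving shift representation. -/
theorem lintegral_spectralLaw_of_movingShift {α : ℝ} (hα : 0 < α) (ν : Measure (ℤ → E))
    (hone : ν {x | 1 < K.nrm (x 0)} = 1)
    {Ω : Type*} [MeasurableSpace Ω] (P : Measure Ω) [IsProbabilityMeasure P]
    (Zt : Ω → ℤ → E) (hZmeas : Measurable Zt)
    (hrep : ∀ A : Set (ℤ → E), MeasurableSet A →
      ν A = ∑' h : ℤ, ∫⁻ r in Set.Ioi (0 : ℝ),
        P {ω | K.sSmul r (seqShift h (Zt ω)) ∈ A}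
          * ENNReal.ofReal (α * r ^ (-α - 1)) ∂volume)
    (F G : (ℤ → E) → ℝ≥0∞) (hF : Measurable F) (hG : Measurable G)
    (hGhom : ∀ (u : ℝ), 0 < u → ∀ x, G (K.sSmul u x) = G x)
    (hFG : ∀ x, 0 < K.nrm (x 0) → F (K.sSmul (K.nrm (x 0))⁻¹ x) = G x) :
    ∫⁻ x, F x ∂(K.spectralLaw ν 0) =
      ∫⁻ ω, ∑' h : ℤ, ENNReal.ofReal (K.nrm (seqShift h (Zt ω) 0)) ^ α *
        G (seqShift h (Zt ω)) ∂P := by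
  have hset : {x : ℤ → E | 1 < K.nrm (x 0)} = {x | 1 < ENNReal.ofReal (K.nrm (x 0))} := by
    simp only [ENNReal.one_lt_ofReal]
  rw [← K.setLIntegral_of_movingShift hα ν P Zt hZmeas hrep
    (fun x => ENNReal.ofReal (K.nrm (x 0))) (K.measurable_nrm_apply 0).ennreal_ofReal
    (fun u hu x => K.ofReal_nrm_sSmul hu x 0) G hG hGhom, ← hset, spectralLaw, hone, inv_one,
    _root_.one_smul, lintegral_map hF K.measurable_spectralMap]
  refine setLIntegral_congr_fun (measurableSet_lt measurable_const (K.measurable_nrm_apply 0))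
    fun x hx => hFG x ?_
  exact zero_lt_one.trans hx

theorem measurableSet_isInfArgmax (j : ℤ) : MeasurableSet {x : ℤ → E | K.IsInfArgmax x j} := by
  have hm : ∀ k : ℤ, Measurable fun x : ℤ → E => ENNReal.ofReal (K.nrm (x k)) := fun k =>
    (K.measurable_nrm_apply k).ennreal_ofReal
  exact (measurableSet_lt (Measurable.iSup fun k => Measurable.iSup fun _ => hm k) (hm j)).inter
    (measurableSet_eq_fun (hm j) (Measurable.iSup hm))

theorem isInfArgmax_sSmul {r : ℝ} (hr : 0 < r) (x : ℤ → E) (j : ℤ) :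
    K.IsInfArgmax (K.sSmul r x) j ↔ K.IsInfArgmax x j := by
  have h0 : ENNReal.ofReal r ≠ 0 := (ENNReal.ofReal_pos.2 hr).ne'
  simp only [IsInfArgmax, K.ofReal_nrm_sSmul hr, ← ENNReal.mul_iSup]
  rw [ENNReal.mul_lt_mul_iff_right h0 ENNReal.ofReal_ne_top,
    ENNReal.mul_right_inj h0 ENNReal.ofReal_ne_top]

theorem isInfArgmax_seqShift (x : ℤ → E) (h j : ℤ) :
    K.IsInfArgmax (seqShift h x) j ↔ K.IsInfArgmax x (j - h) := by
  have h1 : (⨆ k : ℤ, ⨆ _ : k < j, ENNReal.ofReal (K.nrm (x (k - h)))) =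
      ⨆ k : ℤ, ⨆ _ : k < j - h, ENNReal.ofReal (K.nrm (x k)) := by
    refine (Equiv.subRight h).iSup_congr fun k => ?_
    simp only [Equiv.subRight_apply, sub_lt_sub_iff_right]
  have h2 : (⨆ k : ℤ, ENNReal.ofReal (K.nrm (x (k - h)))) =
      ⨆ k : ℤ, ENNReal.ofReal (K.nrm (x k)) :=
    (Equiv.subRight h).iSup_congr fun k => rfl
  simp only [IsInfArgmax, seqShift, h1, h2]

variable {K} in
theorem IsInfArgmax.unique {x : ℤ → E} {i j : ℤ} (hi : K.IsInfArgmax x i)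
    (hj : K.IsInfArgmax x j) : i = j := by
  have aux : ∀ i j : ℤ, K.IsInfArgmax x i → K.IsInfArgmax x j → ¬ i < j := by
    intro i j hi hj hij
    refine absurd hj.1 (not_lt.2 ?_)
    rw [hj.2, ← hi.2]
    exact le_iSup₂ (f := fun (k : ℤ) (_ : k < j) => ENNReal.ofReal (K.nrm (x k))) i hij
  exact le_antisymm (not_lt.1 (aux j i hj hi)) (not_lt.1 (aux i j hi hj))

theorem exists_isInfArgmax {α : ℝ} (hα : 0 < α) (x : ℤ → E)
    (hsum : ∑' k : ℤ, ENNReal.ofReal (K.nrm (x k)) ^ α ≠ ⊤) {i : ℤ} (hi : 0 < K.nrm (x i)) :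
    ∃ j, K.IsInfArgmax x j := by
  set b : ℤ → ℝ≥0∞ := fun k => ENNReal.ofReal (K.nrm (x k)) with hb
  have hfin : ∀ c : ℝ≥0∞, c ≠ 0 → {k | c ≤ b k}.Finite := by
    intro c hc
    have h0 : c ^ α ≠ 0 := fun h => hc ((ENNReal.rpow_eq_zero_iff_of_pos hα).1 h)
    refine (ENNReal.finite_const_le_of_tsum_ne_top hsum h0).subset fun k hk => ?_
    exact ENNReal.rpow_le_rpow hk hα.le
  have hbi : b i ≠ 0 := (ENNReal.ofReal_pos.2 hi).ne'
  obtain ⟨m, hm, hmax⟩ := Set.exists_max_image {k | b i ≤ b k} b (hfin _ hbi)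
    ⟨i, le_refl (b i)⟩
  have hle : ∀ k, b k ≤ b m := by
    intro k
    by_cases hk : b i ≤ b k
    · exact hmax k hk
    · exact (not_le.1 hk).le.trans hm
  have hm0 : b m ≠ 0 := fun h => hbi (le_zero_iff.1 (h ▸ hm))
  obtain ⟨j, hj, hmin⟩ := Set.exists_min_image {k | b m ≤ b k} id (hfin _ hm0)
    ⟨m, le_refl (b m)⟩
  have hjm : b j = b m := le_antisymm (hle j) hj
  have hlt : ∀ k, k < j → b k < b m := by
    intro k hk
    by_contra hcon
    exact absurd (hmin k (not_lt.1 hcon)) (not_le.2 hk)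
  refine ⟨j, ?_, ?_⟩
  · change (⨆ k : ℤ, ⨆ _ : k < j, b k) < b j
    have hhalf : b m / 2 ≠ 0 := by simpa using hm0
    set F := ((hfin _ hhalf).toFinset).filter (· < j) with hF
    have hsup : F.sup b < b m := by
      rw [Finset.sup_lt_iff (pos_iff_ne_zero.2 hm0)]
      exact fun k hk => hlt k (Finset.mem_filter.1 hk).2
    rw [hjm]
    refine lt_of_le_of_lt (b := F.sup b ⊔ b m / 2) (iSup₂_le fun k hk => ?_)
      (max_lt hsup (ENNReal.half_lt_self hm0 ENNReal.ofReal_ne_top))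
    by_cases hk2 : b m / 2 ≤ b k
    · exact le_sup_of_le_left (Finset.le_sup (f := b) (by simp [hF, hk, hk2]))
    · exact le_sup_of_le_right (not_le.1 hk2).le
  · change b j = ⨆ k, b k
    exact le_antisymm (le_iSup b j) (iSup_le fun k => (hle k).trans hj)

end

end MeasCone

open MeasCone in
/-- for a dissipative shift-invariant tail measure with moving shift
representation `Z̃` (law `ρ`) and spectral tail process `Θ`, the maximal index `θ_τ` is
positive and equals `E[sup_h τ^α(B^h Z̃)]`, equals
`E[sup_h τ^α(B^h Θ)/Σ_h ‖Θ_h‖^α]`, and, if `P(I(Θ)=0) > 0`,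
equals `P(I(Θ)=0)·E[sup_h τ^α(B^h Q)]` where `Q` has the conditional law of `Θ` given
`I(Θ) = 0`. -/
theorem maximalIndex_formulas
    {E : Type*} [MeasurableSpace E] (K : MeasCone E) (α : ℝ) (hα : 0 < α)
    (ν : Measure (ℤ → E)) (hν : K.IsTailMeasure α ν) (hs : ShiftInvariant ν)
    {Ω : Type*} [MeasurableSpace Ω] (P : Measure Ω) [IsProbabilityMeasure P]
    (Zt : Ω → ℤ → E) (hZmeas : Measurable Zt)
    (hrep : ∀ A : Set (ℤ → E), MeasurableSet A →
      ν A = ∑' h : ℤ, ∫⁻ r in Set.Ioi (0 : ℝ),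
        P {ω | K.sSmul r (seqShift h (Zt ω)) ∈ A}
          * ENNReal.ofReal (α * r ^ (-α - 1)) ∂volume)
    (τ : (ℤ → E) → ℝ≥0∞) (hτmeas : Measurable τ)
    (hτhom : ∀ (u : ℝ), 0 < u → ∀ x, τ (K.sSmul u x) = ENNReal.ofReal u * τ x)
    (hτone : ν {x | 1 < τ x} = 1)
    (u : ℕ → ℝ≥0∞)
    (hu : ∀ n : ℕ, u n = ν {x | ∃ h : ℕ, h < n ∧ 1 < τ (seqShift (h : ℤ) x)})
    (θ : ℝ≥0∞)
    (hθ : Filter.Tendsto (fun n : ℕ => u n / (n : ℝ≥0∞)) Filter.atTop (nhds θ)) :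
    0 < θ ∧
    θ = ∫⁻ ω, ⨆ h : ℤ, τ (seqShift h (Zt ω)) ^ α ∂P ∧
    θ = ∫⁻ x, (⨆ h : ℤ, τ (seqShift h x) ^ α)
          / (∑' h : ℤ, ENNReal.ofReal (K.nrm (x h) ^ α)) ∂(K.spectralLaw ν 0) ∧
    (0 < K.spectralLaw ν 0 {x | K.IsInfArgmax x 0} →
      θ = K.spectralLaw ν 0 {x | K.IsInfArgmax x 0} *
        ∫⁻ x, ⨆ h : ℤ, τ (seqShift h x) ^ α
          ∂((K.spectralLaw ν 0 {x | K.IsInfArgmax x 0})⁻¹ •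
              (K.spectralLaw ν 0).restrict {x | K.IsInfArgmax x 0})) := by
  have hshift : ∀ h : ℤ, Measurable fun ω => seqShift h (Zt ω) := fun h =>
    (measurable_seqShift h).comp hZmeas
  have hameas : ∀ h : ℤ, Measurable fun ω => τ (seqShift h (Zt ω)) ^ α := fun h =>
    (hτmeas.comp (hshift h)).pow_const α
  set M : (ℤ → E) → ℝ≥0∞ := fun x => ⨆ h : ℤ, τ (seqShift h x) ^ α with hMdef
  have hMmeas : Measurable M :=
    Measurable.iSup fun h => (hτmeas.comp (measurable_seqShift h)).pow_const α
  have hMshift : ∀ (h : ℤ) x, M (seqShift h x) = M x := by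
    intro h x
    simp only [hMdef, seqShift_seqShift]
    exact (Equiv.addLeft h).iSup_congr fun k => rfl
  have hMhom : ∀ r : ℝ, 0 < r → ∀ x, M (K.sSmul r x) = ENNReal.ofReal r ^ α * M x := by
    intro r hr x
    simp only [hMdef, K.seqShift_sSmul, hτhom r hr, ENNReal.mul_rpow_of_nonneg _ _ hα.le,
      ENNReal.mul_iSup]
  set S : (ℤ → E) → ℝ≥0∞ := fun x => ∑' h : ℤ, ENNReal.ofReal (K.nrm (x h)) ^ α with hSdef
  have hSmeas : Measurable S := Measurable.tsum fun h =>
    (K.measurable_nrm_apply h).ennreal_ofReal.pow_const α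
  have hSshift : ∀ (h : ℤ) x, S (seqShift h x) = S x := by
    intro h x
    exact (Equiv.subRight h).tsum_eq fun k => ENNReal.ofReal (K.nrm (x k)) ^ α
  have hSshift' : ∀ x, ∑' h : ℤ, ENNReal.ofReal (K.nrm (seqShift h x 0)) ^ α = S x := by
    intro x
    exact (Equiv.subLeft (0 : ℤ)).tsum_eq fun k => ENNReal.ofReal (K.nrm (x k)) ^ α
  have hShom : ∀ r : ℝ, 0 < r → ∀ x, S (K.sSmul r x) = ENNReal.ofReal r ^ α * S x := by
    intro r hr x
    simp only [hSdef, K.ofReal_nrm_sSmul hr, ENNReal.mul_rpow_of_nonneg _ _ hα.le,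
      ENNReal.tsum_mul_left]
  have hrpow0 : ∀ r : ℝ, 0 < r → ENNReal.ofReal r ^ α ≠ 0 := fun r hr h =>
    (ENNReal.ofReal_pos.2 hr).ne' ((ENNReal.rpow_eq_zero_iff_of_pos hα).1 h)
  have hrpowT : ∀ r : ℝ, ENNReal.ofReal r ^ α ≠ ⊤ := fun r =>
    ENNReal.rpow_ne_top_of_nonneg hα.le ENNReal.ofReal_ne_top
  have exceed : ∀ φ : (ℤ → E) → ℝ≥0∞, Measurable φ →
      (∀ (u : ℝ), 0 < u → ∀ x, φ (K.sSmul u x) = ENNReal.ofReal u * φ x) →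
      ν {x | 1 < φ x} = ∫⁻ ω, ∑' h : ℤ, φ (seqShift h (Zt ω)) ^ α ∂P := by
    intro φ hφ hφhom
    simpa using K.setLIntegral_of_movingShift hα ν P Zt hZmeas hrep φ hφ hφhom (fun _ => 1)
      measurable_const fun _ _ _ => rfl
  have hasum : ∑' h : ℤ, ∫⁻ ω, τ (seqShift h (Zt ω)) ^ α ∂P = 1 := by
    rw [← lintegral_tsum fun h => (hameas h).aemeasurable, ← exceed τ hτmeas hτhom, hτone]
  have hSint : ∫⁻ ω, S (Zt ω) ∂P = 1 := by
    rw [← hν.2.1]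
    have := exceed (fun x => ENNReal.ofReal (K.nrm (x 0)))
      (K.measurable_nrm_apply 0).ennreal_ofReal fun u hu x => K.ofReal_nrm_sSmul hu x 0
    simp only [ENNReal.one_lt_ofReal, hSshift'] at this
    exact this.symm
  have hθM : θ = ∫⁻ ω, M (Zt ω) ∂P := by
    refine limit_window_eq P (fun h ω => τ (seqShift h (Zt ω)) ^ α) hameas
      (by rw [hasum]; exact ENNReal.one_ne_top) u (fun n => ?_) θ hθ
    have hset : {x : ℤ → E | ∃ h : ℕ, h < n ∧ 1 < τ (seqShift (h : ℤ) x)} =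
        {x | 1 < ⨆ k : ℕ, ⨆ _ : k < n, τ (seqShift (k : ℤ) x)} := by
      ext x
      simp only [Set.mem_ofPred_eq, lt_iSup_iff, exists_prop]
    rw [hu n, hset, exceed]
    · refine lintegral_congr fun ω => tsum_congr fun h => ?_
      simp only [seqShift_seqShift]
      exact ((ENNReal.orderIsoRpow α hα).map_iSup _).trans
        (iSup_congr fun k => (ENNReal.orderIsoRpow α hα).map_iSup _)
    · exact Measurable.iSup fun k => Measurable.iSup fun _ =>
        hτmeas.comp (measurable_seqShift (k : ℤ))
    · intro r hr x
      simp only [K.seqShift_sSmul, hτhom r hr, ENNReal.mul_iSup]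
  have hMle : ∫⁻ ω, M (Zt ω) ∂P ≤ 1 := by
    rw [← hasum, ← lintegral_tsum fun h => (hameas h).aemeasurable]
    exact lintegral_mono fun ω => iSup_le fun h => ENNReal.le_tsum h
  have hMfin : ∀ᵐ ω ∂P, M (Zt ω) < ⊤ :=
    ae_lt_top (hMmeas.comp hZmeas) (ne_top_of_le_ne_top ENNReal.one_ne_top hMle)
  have hSfin : ∀ᵐ ω ∂P, S (Zt ω) < ⊤ :=
    ae_lt_top (hSmeas.comp hZmeas) (by rw [hSint]; exact ENNReal.one_ne_top)
  have hzero : ∀ x, (∀ k, K.nrm (x k) = 0) → M x < ⊤ → M x = 0 := by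
    intro x hx hfin
    have h2 : K.sSmul 2 x = x := by
      funext k
      rw [sSmul, K.eq_zero_of_nrm _ (hx k), K.smul_zero' 2 two_pos]
    refine ENNReal.iSup_eq_zero.2 fun h => ?_
    have hτ2 : τ (seqShift h x) = ENNReal.ofReal 2 * τ (seqShift h x) := by
      rw [← hτhom 2 two_pos, ← K.seqShift_sSmul, h2]
    have hτfin : τ (seqShift h x) ≠ ⊤ := by
      intro htop
      have hle : τ (seqShift h x) ^ α ≤ M x := le_iSup (fun h : ℤ => τ (seqShift h x) ^ α) h
      rw [htop, ENNReal.top_rpow_of_pos hα] at hle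
      exact hfin.ne (top_le_iff.1 hle)
    have : τ (seqShift h x) = 0 := by
      have hreal := congrArg ENNReal.toReal hτ2
      rw [ENNReal.toReal_mul, ENNReal.toReal_ofReal two_pos.le] at hreal
      exact ((ENNReal.toReal_eq_zero_iff _).1 (by linarith)).resolve_right hτfin
    rw [this, ENNReal.zero_rpow_of_pos hα]
  refine ⟨?_, hθM, ?_, ?_⟩
  · rw [pos_iff_ne_zero, hθM]
    intro h0
    have hae := (lintegral_eq_zero_iff (hMmeas.comp hZmeas)).1 h0
    have : ∑' h : ℤ, ∫⁻ ω, τ (seqShift h (Zt ω)) ^ α ∂P = 0 := by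
      refine ENNReal.tsum_eq_zero.2 fun h => (lintegral_eq_zero_iff (hameas h)).2 ?_
      filter_upwards [hae] with ω hω
      exact ENNReal.iSup_eq_zero.1 hω h
    rw [hasum] at this
    exact one_ne_zero this
  · have hhom : ∀ r : ℝ, 0 < r → ∀ x, M (K.sSmul r x) / S (K.sSmul r x) = M x / S x := by
      intro r hr x
      rw [hMhom r hr, hShom r hr, ENNReal.mul_div_mul_left _ _ (hrpow0 r hr) (hrpowT r)]
    have hden : ∀ x : ℤ → E, ∑' h : ℤ, ENNReal.ofReal (K.nrm (x h) ^ α) = S x := fun x =>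
      tsum_congr fun h => (ENNReal.ofReal_rpow_of_nonneg (K.nrm_nonneg _) hα.le).symm
    simp only [hden]
    rw [K.lintegral_spectralLaw_of_movingShift hα ν hν.2.1 P Zt hZmeas hrep
      (fun x => M x / S x) (fun x => M x / S x) (hMmeas.div hSmeas) (hMmeas.div hSmeas) hhom
      (fun x hx => hhom _ (inv_pos.2 hx) x), hθM]
    refine lintegral_congr_ae ?_
    filter_upwards [hMfin, hSfin] with ω hMω hSω
    simp only [hMshift, hSshift]
    rw [ENNReal.tsum_mul_right, hSshift']
    rcases eq_or_ne (S (Zt ω)) 0 with h0 | h0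
    · rw [h0, zero_mul]
      refine hzero _ (fun k => ?_) hMω
      have hk := (ENNReal.rpow_eq_zero_iff_of_pos hα).1 (ENNReal.tsum_eq_zero.1 h0 k)
      exact le_antisymm (ENNReal.ofReal_eq_zero.1 hk) (K.nrm_nonneg _)
    · rw [ENNReal.mul_div_cancel h0 hSω.ne]
  · intro hpos
    set A : Set (ℤ → E) := {x | K.IsInfArgmax x 0} with hA
    have hAmeas : MeasurableSet A := K.measurableSet_isInfArgmax 0
    have hAhom : ∀ r : ℝ, 0 < r → ∀ x, A.indicator M (K.sSmul r x) =
        ENNReal.ofReal r ^ α * A.indicator M x := by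
      intro r hr x
      by_cases hx : K.IsInfArgmax x 0
      · rw [Set.indicator_of_mem (show x ∈ A from hx), Set.indicator_of_mem
          (show K.sSmul r x ∈ A from (K.isInfArgmax_sSmul hr x 0).2 hx), hMhom r hr]
      · rw [Set.indicator_of_notMem (show x ∉ A from hx), Set.indicator_of_notMem
          (show K.sSmul r x ∉ A from fun h => hx ((K.isInfArgmax_sSmul hr x 0).1 h)), mul_zero]
    have hFmeas : Measurable (A.indicator M) := hMmeas.indicator hAmeas
    have hfin : K.spectralLaw ν 0 A ≠ ⊤ := by
      refine ne_top_of_le_ne_top ENNReal.one_ne_top ((measure_mono (Set.subset_univ A)).trans ?_)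
      rw [spectralLaw, Measure.map_apply K.measurable_spectralMap MeasurableSet.univ, hν.2.1]
      simp [hν.2.1]
    rw [lintegral_smul_measure, smul_eq_mul, ← mul_assoc,
      ENNReal.mul_inv_cancel hpos.ne' hfin, one_mul, ← lintegral_indicator hAmeas,
      K.lintegral_spectralLaw_of_movingShift hα ν hν.2.1 P Zt hZmeas hrep (A.indicator M)
        (fun x => A.indicator M x / ENNReal.ofReal (K.nrm (x 0)) ^ α) hFmeas
        (hFmeas.div ((K.measurable_nrm_apply 0).ennreal_ofReal.pow_const α)), hθM]
    · refine lintegral_congr_ae ?_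
      filter_upwards [hMfin, hSfin] with ω hMω hSω
      have hterm : ∀ h : ℤ, ENNReal.ofReal (K.nrm (seqShift h (Zt ω) 0)) ^ α *
          (A.indicator M (seqShift h (Zt ω)) /
            ENNReal.ofReal (K.nrm (seqShift h (Zt ω) 0)) ^ α) =
          A.indicator M (seqShift h (Zt ω)) := by
        intro h
        by_cases hx : K.IsInfArgmax (seqShift h (Zt ω)) 0
        · have hn := ENNReal.ofReal_pos.1 (zero_le.trans_lt hx.1)
          rw [ENNReal.mul_div_cancel (hrpow0 _ hn) (hrpowT _)]
        · rw [Set.indicator_of_notMem (show seqShift h (Zt ω) ∉ A from hx)]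
          simp
      simp only [hterm]
      by_cases hall : ∀ k, K.nrm (Zt ω k) = 0
      · have h0 := hzero _ hall hMω
        rw [h0]
        refine (ENNReal.tsum_eq_zero.2 fun h => ?_).symm
        refine le_zero_iff.1 ((Set.indicator_le_self A M _).trans ?_)
        rw [hMshift, h0]
      · push Not at hall
        obtain ⟨i, hi⟩ := hall
        obtain ⟨j, hj⟩ := K.exists_isInfArgmax hα (Zt ω) hSω.ne
          (lt_of_le_of_ne (K.nrm_nonneg _) hi.symm)
        have hmem : ∀ h : ℤ, seqShift h (Zt ω) ∈ A ↔ K.IsInfArgmax (Zt ω) (0 - h) := fun h =>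
          K.isInfArgmax_seqShift (Zt ω) h 0
        rw [tsum_eq_single (-j)]
        · rw [Set.indicator_of_mem ((hmem _).2 (by simpa using hj)), hMshift]
        · intro h hne
          refine Set.indicator_of_notMem (fun hh => hne ?_) _
          have := hj.unique ((hmem h).1 hh)
          omega
    · intro r hr x
      rw [hAhom r hr, K.ofReal_nrm_sSmul hr, ENNReal.mul_rpow_of_nonneg _ _ hα.le,
        ENNReal.mul_div_mul_left _ _ (hrpow0 r hr) (hrpowT r)]
    · intro x hx
      rw [hAhom _ (inv_pos.2 hx), ENNReal.ofReal_inv_of_pos hx, ENNReal.inv_rpow, mul_comm,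
        div_eq_mul_inv]
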